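/- arXiv:2107.03495 — 2 statements merged into one kernel-verified Lean document; each statement's English description precedes it below -/
import Mathlib

section
/- Torsion function upper bound: Let n ≥ 2 and T > 0. There is a constant C(n, T) such that for every nonempty bounded open set Ω ⊆ ℝ^n with tor(Ω) ≥ −T, the torsion function w_Ω satisfies w_Ω ≤ C(n, T) almost everywhere on ℝ^n. -/
open MeasureTheory Metric Set Filter Bornology
open scoped ENNReal NNReal Topology

noncomputable section

abbrev Euc (n : ℕ) := EuclideanSpace ℝ (Fin n)

/-- A smooth test function compactly supported in `Ω`. -/
def IsTestFun {n : ℕ} (Ω : Set (Euc n)) (φ : Euc n → ℝ) : Prop :=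
  ContDiff ℝ (⊤ : ℕ∞) φ ∧ HasCompactSupport φ ∧ tsupport φ ⊆ Ω

/-- `u` belongs to `H¹₀(Ω)` with weak gradient `Du`: it is an `L²` limit of smooth
functions compactly supported in `Ω` whose gradients converge to `Du` in `L²`. -/
def MemH10 {n : ℕ} (Ω : Set (Euc n)) (u : Euc n → ℝ) (Du : Euc n → Euc n) : Prop :=
  MemLp u 2 volume ∧ MemLp Du 2 volume ∧
  ∃ φ : ℕ → Euc n → ℝ, (∀ k, IsTestFun Ω (φ k)) ∧
    Tendsto (fun k => ∫ x, (φ k x - u x) ^ 2) atTop (𝓝 0) ∧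
    Tendsto (fun k => ∫ x, ‖gradient (φ k) x - Du x‖ ^ 2) atTop (𝓝 0)

/-- First Dirichlet eigenvalue: infimum of the Rayleigh quotient over `H¹₀(Ω)`. -/
def lam1 {n : ℕ} (Ω : Set (Euc n)) : ℝ :=
  sInf {r | ∃ u Du, MemH10 Ω u Du ∧ (∫ x, u x ^ 2) ≠ 0 ∧
    r = (∫ x, ‖Du x‖ ^ 2) / (∫ x, u x ^ 2)}

/-- Torsional rigidity: `tor Ω = inf { ∫ (½|∇w|² − w) : w ∈ H¹₀(Ω) }`. -/
def tor {n : ℕ} (Ω : Set (Euc n)) : ℝ :=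
  sInf {r | ∃ w Dw, MemH10 Ω w Dw ∧ r = ∫ x, ((1 / 2) * ‖Dw x‖ ^ 2 - w x)}

/-- Normalized first eigenfunction of `Ω`, extended by zero outside `Ω`. -/
def IsEigenfun {n : ℕ} (Ω : Set (Euc n)) (u : Euc n → ℝ) : Prop :=
  (∀ᵐ x ∂volume, 0 ≤ u x) ∧ (∀ x ∉ Ω, u x = 0) ∧ (∫ x, u x ^ 2) = 1 ∧
  ∃ Du, MemH10 Ω u Du ∧ (∫ x, ‖Du x‖ ^ 2) = lam1 Ω

/-- The torsion function of `Ω` (the minimizer of the torsion energy),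
extended by zero outside `Ω`. -/
def IsTorsionFun {n : ℕ} (Ω : Set (Euc n)) (w : Euc n → ℝ) : Prop :=
  (∀ x ∉ Ω, w x = 0) ∧
  ∃ Dw, MemH10 Ω w Dw ∧ (∫ x, ((1 / 2) * ‖Dw x‖ ^ 2 - w x)) = tor Ω

abbrev HH : ℝ → ℝ := Real.smoothTransition

def GG (s : ℝ) : ℝ := ∫ t in (0:ℝ)..s, HH t

lemma HH_contDiff : ContDiff ℝ (⊤ : ℕ∞) HH := Real.smoothTransition.contDiff

lemma HH_cont : Continuous HH := Real.smoothTransition.continuous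

lemma HH_hasDeriv (s : ℝ) : HasDerivAt HH (deriv HH s) s :=
  ((HH_contDiff.differentiable (by simp)) s).hasDerivAt

lemma HH_deriv_cont : Continuous (deriv HH) := HH_contDiff.continuous_deriv (by simp)

lemma HH_deriv_nonneg (s : ℝ) : 0 ≤ deriv HH s := Real.smoothTransition.monotone.deriv_nonneg

lemma HH_deriv_of_one_lt {s : ℝ} (h : 1 < s) : deriv HH s = 0 := by
  have : HH =ᶠ[𝓝 s] fun _ => (1:ℝ) := by
    filter_upwards [lt_mem_nhds h] with y hy
    exact Real.smoothTransition.one_of_one_le hy.le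
  rw [this.deriv_eq]; simp

lemma HH_deriv_of_neg {s : ℝ} (h : s < 0) : deriv HH s = 0 := by
  have : HH =ᶠ[𝓝 s] fun _ => (0:ℝ) := by
    filter_upwards [gt_mem_nhds h] with y hy
    exact Real.smoothTransition.zero_of_nonpos hy.le
  rw [this.deriv_eq]; simp

lemma HH_deriv_bdd : ∃ K : ℝ, 0 ≤ K ∧ ∀ s, |deriv HH s| ≤ K := by
  have hc : HasCompactSupport (deriv HH) := by
    apply HasCompactSupport.intro (isCompact_Icc (a := (0:ℝ)) (b := 1))
    intro x hx
    simp only [mem_Icc, not_and_or, not_le] at hx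
    rcases hx with hx | hx
    · exact HH_deriv_of_neg hx
    · exact HH_deriv_of_one_lt hx
  obtain ⟨C, hC⟩ := hc.exists_bound_of_continuous HH_deriv_cont
  exact ⟨C, (norm_nonneg _).trans (hC 0), hC⟩

lemma GG_hasDeriv (s : ℝ) : HasDerivAt GG (HH s) s :=
  intervalIntegral.integral_hasDerivAt_right (HH_cont.intervalIntegrable _ _)
    (HH_cont.stronglyMeasurableAtFilter _ _) HH_cont.continuousAt

lemma GG_deriv : deriv GG = HH := funext fun s => (GG_hasDeriv s).deriv

lemma GG_contDiff : ContDiff ℝ (⊤ : ℕ∞) GG := by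
  rw [contDiff_infty_iff_deriv, GG_deriv]
  exact ⟨fun s => (GG_hasDeriv s).differentiableAt, HH_contDiff⟩

lemma GG_zero : GG 0 = 0 := by simp [GG]

lemma GG_of_nonpos {s : ℝ} (h : s ≤ 0) : GG s = 0 := by
  unfold GG
  rw [intervalIntegral.integral_congr (g := fun _ => (0:ℝ))]
  · simp
  · intro t ht
    rw [uIcc_of_ge h] at ht
    exact Real.smoothTransition.zero_of_nonpos ht.2

lemma GG_mono : Monotone GG := monotone_of_deriv_nonneg
  (fun s => (GG_hasDeriv s).differentiableAt)
  (fun s => by rw [GG_deriv]; exact Real.smoothTransition.nonneg s)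

lemma GG_nonneg (s : ℝ) : 0 ≤ GG s := by
  rcases le_total s 0 with h | h
  · rw [GG_of_nonpos h]
  · rw [← GG_zero]; exact GG_mono h

lemma GG_ge (s : ℝ) : s - 1 ≤ GG s := by
  rcases le_total s 1 with h | h
  · linarith [GG_nonneg s]
  · have hd : ∀ y, HasDerivAt (fun y => y - GG y) (1 - HH y) y :=
      fun y => (hasDerivAt_id y).sub (GG_hasDeriv y)
    have ha : AntitoneOn (fun y => y - GG y) (Ici 1) := by
      apply antitoneOn_of_deriv_nonpos (convex_Ici 1)
      · exact fun y _ => (hd y).continuousAt.continuousWithinAt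
      · exact fun y _ => (hd y).differentiableAt.differentiableWithinAt
      · intro y hy
        rw [interior_Ici] at hy
        rw [(hd y).deriv, show HH y = 1 from Real.smoothTransition.one_of_one_le (le_of_lt hy)]
        simp
    have := ha (mem_Ici.2 le_rfl) (mem_Ici.2 h) h
    simp only at this
    linarith [GG_nonneg 1]

lemma sq_norm_int {n : ℕ} {E : Type*} [NormedAddCommGroup E] {f : Euc n → E}
    (hf : MemLp f 2 volume) : Integrable (fun x => ‖f x‖ ^ 2) :=
  (memLp_two_iff_integrable_sq_norm hf.1).1 hf

lemma inner_int {n : ℕ} {E : Type*} [NormedAddCommGroup E] [InnerProductSpace ℝ E]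
    {f g : Euc n → E} (hf : MemLp f 2 volume) (hg : MemLp g 2 volume) :
    Integrable (fun x => inner ℝ (f x) (g x)) := by
  refine ((hf.norm.integrable_mul hg.norm)).mono' (hf.1.inner hg.1) ?_
  filter_upwards with x
  exact abs_real_inner_le_norm _ _

lemma tendsto_inner_zero {n : ℕ} {E : Type*} [NormedAddCommGroup E] [InnerProductSpace ℝ E]
    {e : ℕ → Euc n → E} {X : Euc n → E} (he : ∀ k, MemLp (e k) 2 volume)
    (hX : MemLp X 2 volume) (h : Tendsto (fun k => ∫ x, ‖e k x‖ ^ 2) atTop (𝓝 0)) :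
    Tendsto (fun k => ∫ x, inner ℝ (e k x) (X x)) atTop (𝓝 0) := by
  have key : ∀ k, |∫ x, inner ℝ (e k x) (X x)| ≤
      Real.sqrt (∫ x, ‖e k x‖ ^ 2) * Real.sqrt (∫ x, ‖X x‖ ^ 2) := by
    intro k
    calc |∫ x, inner ℝ (e k x) (X x)| ≤ ∫ x, |inner ℝ (e k x) (X x)| := abs_integral_le_integral_abs
      _ ≤ ∫ x, ‖e k x‖ * ‖X x‖ := by
        apply integral_mono (inner_int (he k) hX).abs ((he k).norm.integrable_mul hX.norm)
        intro x; exact abs_real_inner_le_norm _ _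
      _ ≤ _ := by
        have := integral_mul_le_Lp_mul_Lq_of_nonneg (μ := (volume : Measure (Euc n)))
          (Real.HolderConjugate.two_two) (f := fun x => ‖e k x‖) (g := fun x => ‖X x‖)
          (by filter_upwards with x; exact norm_nonneg _)
          (by filter_upwards with x; exact norm_nonneg _) (by simpa using (he k).norm)
          (by simpa using hX.norm)
        simpa [Real.sqrt_eq_rpow] using this
  have h2 : Tendsto (fun k => Real.sqrt (∫ x, ‖e k x‖ ^ 2) * Real.sqrt (∫ x, ‖X x‖ ^ 2))
      atTop (𝓝 0) := by
    have := ((Real.continuous_sqrt.tendsto 0).comp h).mul_const (Real.sqrt (∫ x, ‖X x‖ ^ 2))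
    simpa using this
  exact squeeze_zero_norm key h2

lemma ae_subseq {n : ℕ} {φ : ℕ → Euc n → ℝ} {u : Euc n → ℝ} (hφ : ∀ k, MemLp (φ k) 2 volume)
    (hu : MemLp u 2 volume) (h : Tendsto (fun k => ∫ x, (φ k x - u x) ^ 2) atTop (𝓝 0)) :
    ∃ ns : ℕ → ℕ, StrictMono ns ∧
      ∀ᵐ x ∂volume, Tendsto (fun i => φ (ns i) x) atTop (𝓝 (u x)) := by
  apply TendstoInMeasure.exists_seq_tendsto_ae
  apply tendstoInMeasure_of_tendsto_eLpNorm (p := 2) (by simp) (fun k => (hφ k).1) hu.1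
  have : ∀ k, eLpNorm (φ k - u) 2 volume = ENNReal.ofReal (Real.sqrt (∫ x, (φ k x - u x) ^ 2)) := by
    intro k
    rw [((hφ k).sub hu).eLpNorm_eq_integral_rpow_norm (by simp) (by simp)]
    simp [Real.sqrt_eq_rpow]
  simp_rw [this]
  have := ENNReal.tendsto_ofReal ((Real.continuous_sqrt.tendsto 0).comp h)
  simpa using this

lemma grad_cont {n : ℕ} {φ : Euc n → ℝ} (h : ContDiff ℝ (⊤ : ℕ∞) φ) : Continuous (gradient φ) := by
  unfold gradient
  exact (InnerProductSpace.toDual ℝ (Euc n)).symm.continuous.comp (h.continuous_fderiv (by simp))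

lemma IsTestFun.memLp {n : ℕ} {Ω : Set (Euc n)} {φ : Euc n → ℝ} (h : IsTestFun Ω φ) :
    MemLp φ 2 volume := h.1.continuous.memLp_of_hasCompactSupport h.2.1

lemma IsTestFun.grad_supp {n : ℕ} {Ω : Set (Euc n)} {φ : Euc n → ℝ} (h : IsTestFun Ω φ) :
    HasCompactSupport (gradient φ) := by
  have := h.2.1.fderiv ℝ
  exact this.comp_left (g := (InnerProductSpace.toDual ℝ (Euc n)).symm) (by simp)

lemma IsTestFun.grad_memLp {n : ℕ} {Ω : Set (Euc n)} {φ : Euc n → ℝ} (h : IsTestFun Ω φ) :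
    MemLp (gradient φ) 2 volume := (grad_cont h.1).memLp_of_hasCompactSupport h.grad_supp
def ss {n : ℕ} (x : Euc n) (t : ℝ) (y : Euc n) : ℝ := ‖y - x‖ ^ 2 / t ^ 2
def eta {n : ℕ} (x : Euc n) (t : ℝ) (y : Euc n) : ℝ := HH (2 - ss x t y)
def psi {n : ℕ} (x : Euc n) (t : ℝ) (y : Euc n) : ℝ := (1 / 2) * GG (2 - ss x t y)
def dv {n : ℕ} (x : Euc n) (t : ℝ) (y : Euc n) : ℝ :=
  n * eta x t y - 2 * ss x t y * deriv HH (2 - ss x t y)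

lemma ss_contDiff {n : ℕ} (x : Euc n) (t : ℝ) : ContDiff ℝ (⊤ : ℕ∞) (ss x t) := by
  unfold ss
  exact ((contDiff_id.sub contDiff_const).norm_sq ℝ).div_const _

lemma ss_hasF {n : ℕ} (x : Euc n) (t : ℝ) (y : Euc n) :
    HasFDerivAt (ss x t) ((2 / t ^ 2) • (innerSL ℝ (y - x))) y := by
  have h := ((hasFDerivAt_id y).sub_const x).norm_sq.mul_const (1 / t ^ 2)
  have e : ss x t = fun y => ‖id y - x‖ ^ 2 * (1 / t ^ 2) := by
    ext z; simp [ss, div_eq_mul_inv]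
  rw [e]
  refine h.congr_fderiv ?_
  ext z; simp; ring

lemma ss_nonneg {n : ℕ} (x : Euc n) (t : ℝ) (y : Euc n) : 0 ≤ ss x t y := by
  unfold ss; positivity

lemma ss_out {n : ℕ} {x : Euc n} {t : ℝ} (ht : 0 < t) {y : Euc n} (hy : y ∉ closedBall x (2 * t)) :
    2 < ss x t y := by
  rw [mem_closedBall, dist_eq_norm, not_le] at hy
  unfold ss
  rw [lt_div_iff₀ (by positivity)]
  nlinarith

lemma ss_in {n : ℕ} {x : Euc n} {t : ℝ} (ht : 0 < t) {y : Euc n} (hy : y ∈ closedBall x t) :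
    ss x t y ≤ 1 := by
  rw [mem_closedBall, dist_eq_norm] at hy
  unfold ss
  rw [div_le_one (by positivity)]
  have := norm_nonneg (y - x)
  nlinarith

lemma ss_in' {n : ℕ} {x : Euc n} {t : ℝ} (ht : 0 < t) {y : Euc n} (hy : y ∈ ball x t) :
    ss x t y < 1 := by
  rw [mem_ball, dist_eq_norm] at hy
  unfold ss
  rw [div_lt_one (by positivity)]
  have := norm_nonneg (y - x)
  nlinarith

lemma eta_contDiff {n : ℕ} (x : Euc n) (t : ℝ) : ContDiff ℝ (⊤ : ℕ∞) (eta x t) :=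
  HH_contDiff.comp (contDiff_const.sub (ss_contDiff x t))

lemma psi_contDiff {n : ℕ} (x : Euc n) (t : ℝ) : ContDiff ℝ (⊤ : ℕ∞) (psi x t) :=
  contDiff_const.mul (GG_contDiff.comp (contDiff_const.sub (ss_contDiff x t)))

lemma dv_cont {n : ℕ} (x : Euc n) (t : ℝ) : Continuous (dv x t) := by
  have h1 := (eta_contDiff x t).continuous
  have h2 := (ss_contDiff x t).continuous
  have h3 := HH_deriv_cont
  unfold dv
  fun_prop

lemma supp_of {n : ℕ} {E : Type*} [Zero E] {x : Euc n} {t : ℝ} (ht : 0 < t)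
    {f : Euc n → E} (h : ∀ y, 2 < ss x t y → f y = 0) : HasCompactSupport f :=
  HasCompactSupport.intro (isCompact_closedBall x (2 * t)) fun y hy => h y (ss_out ht hy)

lemma eta_zero {n : ℕ} {x : Euc n} {t : ℝ} {y : Euc n} (h : 2 < ss x t y) : eta x t y = 0 :=
  Real.smoothTransition.zero_of_nonpos (by linarith)

lemma psi_zero {n : ℕ} {x : Euc n} {t : ℝ} {y : Euc n} (h : 2 < ss x t y) : psi x t y = 0 := by
  simp [psi, GG_of_nonpos (show 2 - ss x t y ≤ 0 by linarith)]

lemma dv_zero {n : ℕ} {x : Euc n} {t : ℝ} {y : Euc n} (h : 2 < ss x t y) : dv x t y = 0 := by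
  simp [dv, eta_zero h, HH_deriv_of_neg (show 2 - ss x t y < 0 by linarith)]

lemma psi_nonneg {n : ℕ} (x : Euc n) (t : ℝ) (y : Euc n) : 0 ≤ psi x t y := by
  unfold psi; have := GG_nonneg (2 - ss x t y); positivity

lemma eta_nonneg {n : ℕ} (x : Euc n) (t : ℝ) (y : Euc n) : 0 ≤ eta x t y :=
  Real.smoothTransition.nonneg _

lemma eta_le {n : ℕ} (x : Euc n) (t : ℝ) (y : Euc n) : eta x t y ≤ 1 :=
  Real.smoothTransition.le_one _

lemma psi_grad {n : ℕ} (x : Euc n) (t : ℝ) (y : Euc n) :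
    gradient (psi x t) y = -(1 / t ^ 2 * eta x t y) • (y - x) := by
  apply HasGradientAt.gradient
  rw [hasGradientAt_iff_hasFDerivAt]
  have h := ((GG_hasDeriv (2 - ss x t y)).comp_hasFDerivAt y ((ss_hasF x t y).const_sub 2)).const_mul
    (1 / 2 : ℝ)
  refine HasFDerivAt.congr_fderiv (f := psi x t) h ?_
  ext z
  simp [eta]
  ring

lemma comp_hasF {n : ℕ} (x : Euc n) (t : ℝ) (y : Euc n) (i : Fin n) :
    fderiv ℝ (fun y => eta x t y * (y i - x i)) y (EuclideanSpace.single i 1) =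
      eta x t y - 2 * ((y i - x i) ^ 2 / t ^ 2) * deriv HH (2 - ss x t y) := by
  have h1 := ((HH_hasDeriv (2 - ss x t y)).comp_hasFDerivAt y ((ss_hasF x t y).const_sub 2))
  have h2 : HasFDerivAt (fun y : Euc n => y i - x i) (EuclideanSpace.proj i : Euc n →L[ℝ] ℝ) y :=
    (EuclideanSpace.proj i : Euc n →L[ℝ] ℝ).hasFDerivAt.sub_const (x i)
  have h := h1.mul h2
  have h' : HasFDerivAt (fun y => eta x t y * (y i - x i)) _ y := h
  rw [h'.fderiv]
  simp [eta, EuclideanSpace.inner_single_right]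
  ring

lemma dv_eq {n : ℕ} (x : Euc n) (t : ℝ) (y : Euc n) :
    dv x t y = ∑ i, (eta x t y - 2 * ((y i - x i) ^ 2 / t ^ 2) * deriv HH (2 - ss x t y)) := by
  rw [Finset.sum_sub_distrib, ← Finset.sum_mul, ← Finset.mul_sum, ← Finset.sum_div]
  simp [dv, ss, EuclideanSpace.norm_sq_eq]

lemma div_test {n : ℕ} {Ω : Set (Euc n)} {φ : Euc n → ℝ} (h : IsTestFun Ω φ) (x : Euc n) (t : ℝ) :
    ∫ y, inner ℝ (gradient φ y) (eta x t y • (y - x)) = - ∫ y, φ y * dv x t y := by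
  have hc : ∀ i : Fin n, ContDiff ℝ (⊤ : ℕ∞) (fun y : Euc n => eta x t y * (y i - x i)) := fun i =>
    (eta_contDiff x t).mul
      ((EuclideanSpace.proj i : Euc n →L[ℝ] ℝ).contDiff.sub contDiff_const)
  have hcf := fun v : Euc n => (h.1.continuous_fderiv (by simp)).clm_apply (continuous_const (y := v))
  have hcg := fun (i : Fin n) (v : Euc n) =>
    ((hc i).continuous_fderiv (by simp)).clm_apply (continuous_const (y := v))
  have i1 : ∀ i : Fin n, Integrable (fun y => φ y *
      fderiv ℝ (fun y => eta x t y * (y i - x i)) y (EuclideanSpace.single i 1)) := fun i =>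
    (h.1.continuous.mul (hcg i _)).integrable_of_hasCompactSupport h.2.1.mul_right
  have i2 : ∀ i : Fin n, Integrable (fun y => fderiv ℝ φ y (EuclideanSpace.single i 1) *
      (eta x t y * (y i - x i))) := fun i =>
    ((hcf _).mul (hc i).continuous).integrable_of_hasCompactSupport
      ((h.2.1.fderiv_apply ℝ _).mul_right)
  have i3 : ∀ i : Fin n, Integrable (fun y => φ y * (eta x t y * (y i - x i))) := fun i =>
    (h.1.continuous.mul (hc i).continuous).integrable_of_hasCompactSupport h.2.1.mul_right
  have key := fun i : Fin n => integral_mul_fderiv_eq_neg_fderiv_mul_of_integrable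
    (i2 i) (i1 i) (i3 i) (fun z _ => h.1.differentiable (by simp) z)
    (fun z _ => (hc i).differentiable (by simp) z)
  have e1 : ∀ y, φ y * dv x t y = ∑ i, φ y *
      fderiv ℝ (fun y => eta x t y * (y i - x i)) y (EuclideanSpace.single i 1) := by
    intro y
    rw [dv_eq, Finset.mul_sum]
    simp_rw [comp_hasF]
  have e2 : ∀ y, inner ℝ (gradient φ y) (eta x t y • (y - x)) =
      ∑ i, fderiv ℝ φ y (EuclideanSpace.single i 1) * (eta x t y * (y i - x i)) := by
    intro y
    simp_rw [← inner_gradient_left, EuclideanSpace.inner_single_right, PiLp.inner_apply]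
    simp
    exact Finset.sum_congr rfl fun i _ => by ring
  simp_rw [e1, e2]
  rw [integral_finsetSum _ (fun i _ => i2 i), integral_finsetSum _ (fun i _ => i1 i)]
  simp_rw [key]
  simp

lemma MemH10.ae_zero {n : ℕ} {Ω : Set (Euc n)} {u : Euc n → ℝ} {Du : Euc n → Euc n}
    (h : MemH10 Ω u Du) : ∀ᵐ x ∂volume, x ∉ Ω → u x = 0 := by
  obtain ⟨hu, hDu, φ, hφ, h1, h2⟩ := h
  obtain ⟨ns, -, hns⟩ := ae_subseq (fun k => (hφ k).memLp) hu h1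
  filter_upwards [hns] with x hx hxΩ
  refine tendsto_nhds_unique hx ?_
  have : ∀ i, φ (ns i) x = 0 := fun i =>
    image_eq_zero_of_notMem_tsupport fun hh => hxΩ ((hφ _).2.2 hh)
  simp [this]

lemma MemH10.integrable {n : ℕ} {Ω : Set (Euc n)} (ho : IsOpen Ω) (hb : IsBounded Ω)
    {u : Euc n → ℝ} {Du : Euc n → Euc n} (h : MemH10 Ω u Du) : Integrable u := by
  have hfin : IsFiniteMeasure ((volume : Measure (Euc n)).restrict Ω) :=
    ⟨by simpa using hb.measure_lt_top⟩
  have h1 : IntegrableOn u Ω := (h.1.restrict Ω).integrable (by norm_num)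
  rw [← integrable_indicator_iff ho.measurableSet] at h1
  refine h1.congr ?_
  filter_upwards [h.ae_zero] with x hx
  by_cases hxΩ : x ∈ Ω <;> simp [hxΩ, hx]

lemma MemH10.div {n : ℕ} {Ω : Set (Euc n)} {u : Euc n → ℝ} {Du : Euc n → Euc n}
    (h : MemH10 Ω u Du) (x : Euc n) {t : ℝ} (ht : 0 < t) :
    ∫ y, inner ℝ (Du y) (eta x t y • (y - x)) = - ∫ y, u y * dv x t y := by
  obtain ⟨hu, hDu, φ, hφ, h1, h2⟩ := h
  have hX : MemLp (fun y => eta x t y • (y - x)) 2 (volume : Measure (Euc n)) := by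
    apply Continuous.memLp_of_hasCompactSupport
    · exact (eta_contDiff x t).continuous.smul (by fun_prop)
    · exact supp_of (x := x) ht (fun y hy => by simp [eta_zero hy])
  have hd : MemLp (dv x t) 2 (volume : Measure (Euc n)) :=
    (dv_cont x t).memLp_of_hasCompactSupport (supp_of ht fun y hy => dv_zero hy)
  have l1 := tendsto_inner_zero (fun k => (hφ k).grad_memLp.sub hDu) hX (by simpa using h2)
  have l2 := tendsto_inner_zero (fun k => (hφ k).memLp.sub hu) hd (by simpa using h1)
  have e1 : ∀ k, (∫ y, inner ℝ ((gradient (φ k) - Du) y) (eta x t y • (y - x))) =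
      (- ∫ y, φ k y * dv x t y) - ∫ y, inner ℝ (Du y) (eta x t y • (y - x)) := by
    intro k
    rw [← div_test (hφ k), ← integral_sub (inner_int (hφ k).grad_memLp hX) (inner_int hDu hX)]
    simp [inner_sub_left]
  have e2 : ∀ k, (∫ y, inner ℝ ((φ k - u) y) (dv x t y)) =
      (∫ y, φ k y * dv x t y) - ∫ y, u y * dv x t y := by
    intro k
    have := integral_sub ((hφ k).memLp.integrable_mul hd) (hu.integrable_mul hd)
    simp only [Pi.mul_apply] at this
    rw [← this]
    congr 1; ext y; simp; ring
  simp_rw [e1] at l1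
  simp_rw [e2] at l2
  have := l1.add l2
  have h3 := tendsto_nhds_unique this (b := - (∫ y, inner ℝ (Du y) (eta x t y • (y - x)))
    - ∫ y, u y * dv x t y) (tendsto_const_nhds.congr fun k => by ring)
  linarith
lemma grad_mul_comp {n : ℕ} {ψ φ : Euc n → ℝ} {F : ℝ → ℝ} (hψ : ContDiff ℝ (⊤ : ℕ∞) ψ)
    (hφ : ContDiff ℝ (⊤ : ℕ∞) φ) (hF : ContDiff ℝ (⊤ : ℕ∞) F) (x : Euc n) :
    gradient (fun y => ψ y * F (φ y)) x =
      F (φ x) • gradient ψ x + (ψ x * deriv F (φ x)) • gradient φ x := by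
  have h1 := (hψ.differentiable (by simp) x).hasFDerivAt
  have h2 := (hφ.differentiable (by simp) x).hasFDerivAt
  have h3 := (hF.differentiable (by simp) (φ x)).hasDerivAt
  have h := (h1.mul (h3.comp_hasFDerivAt x h2)).fderiv
  have h' : fderiv ℝ (fun y => ψ y * F (φ y)) x = _ := h
  unfold gradient
  rw [h']
  simp [mul_smul]
  abel

lemma three_sq {E : Type*} [SeminormedAddCommGroup E] (a b c : E) :
    ‖a + b + c‖ ^ 2 ≤ 3 * (‖a‖ ^ 2 + ‖b‖ ^ 2 + ‖c‖ ^ 2) := by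
  have h := norm_add₃_le (a := a) (b := b) (c := c)
  have h0 := norm_nonneg (a + b + c)
  nlinarith [sq_nonneg (‖a‖ - ‖b‖), sq_nonneg (‖a‖ - ‖c‖), sq_nonneg (‖b‖ - ‖c‖)]

lemma lip_of_deriv {F : ℝ → ℝ} (hF : ContDiff ℝ (⊤ : ℕ∞) F) {K : ℝ} (hK : ∀ s, |deriv F s| ≤ K)
    (a b : ℝ) : |F a - F b| ≤ K * |a - b| := by
  have := Convex.norm_image_sub_le_of_norm_deriv_le (f := F) (s := univ) (x := b) (y := a) (C := K)
    (fun x _ => hF.differentiable (by simp) x) (fun x _ => hK x) convex_univ trivial trivial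
  simpa using this

lemma MemH10.mul_comp {n : ℕ} {Ω : Set (Euc n)} {u : Euc n → ℝ} {Du : Euc n → Euc n}
    (h : MemH10 Ω u Du) {ψ : Euc n → ℝ} (hψ : ContDiff ℝ (⊤ : ℕ∞) ψ) {A B : ℝ}
    (hA : ∀ x, |ψ x| ≤ A) (hB : ∀ x, ‖gradient ψ x‖ ≤ B) {F : ℝ → ℝ}
    (hF : ContDiff ℝ (⊤ : ℕ∞) F) (hF0 : F 0 = 0) {K : ℝ} (hK : ∀ s, |deriv F s| ≤ K) :
    MemH10 Ω (fun x => ψ x * F (u x))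
      (fun x => F (u x) • gradient ψ x + (ψ x * deriv F (u x)) • Du x) := by
  obtain ⟨hu, hDu, φ, hφ, h1, h2⟩ := h
  obtain ⟨ns, hmono, hns⟩ := ae_subseq (fun k => (hφ k).memLp) hu h1
  have hA0 : 0 ≤ A := (abs_nonneg _).trans (hA 0)
  have hB0 : 0 ≤ B := (norm_nonneg _).trans (hB 0)
  have hK0 : 0 ≤ K := (abs_nonneg _).trans (hK 0)
  have hlip := lip_of_deriv hF hK
  have hF'c : Continuous (deriv F) := hF.continuous_deriv (by simp)
  have hFu : ∀ s, |F s| ≤ K * |s| := fun s => by simpa [hF0] using hlip s 0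
  have hFmeas : AEStronglyMeasurable (fun x => F (u x)) volume :=
    hF.continuous.comp_aestronglyMeasurable hu.1
  have hF'meas : AEStronglyMeasurable (fun x => deriv F (u x)) volume :=
    hF'c.comp_aestronglyMeasurable hu.1
  have hψm : AEStronglyMeasurable ψ (volume : Measure (Euc n)) :=
    hψ.continuous.aestronglyMeasurable
  have hgm : AEStronglyMeasurable (gradient ψ) (volume : Measure (Euc n)) :=
    (grad_cont hψ).aestronglyMeasurable
  have hFL : MemLp (fun x => F (u x)) 2 volume :=
    hu.of_le_mul hFmeas (c := K) (by filter_upwards with x; exact hFu _)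
  have m1 : MemLp (fun x => ψ x * F (u x)) 2 volume := by
    refine hFL.of_le_mul (hψm.mul hFmeas) (c := A) ?_
    filter_upwards with x
    rw [norm_mul]
    exact mul_le_mul_of_nonneg_right (hA x) (norm_nonneg _)
  have m2 : MemLp (fun x => F (u x) • gradient ψ x) 2 volume := by
    refine hFL.of_le_mul (hFmeas.smul hgm) (c := B) ?_
    filter_upwards with x
    rw [norm_smul, mul_comm]
    exact mul_le_mul_of_nonneg_right (hB x) (norm_nonneg _)
  have m3 : MemLp (fun x => (ψ x * deriv F (u x)) • Du x) 2 volume := by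
    refine hDu.of_le_mul ((hψm.mul hF'meas).smul hDu.1) (c := A * K) ?_
    filter_upwards with x
    rw [norm_smul, norm_mul]
    exact mul_le_mul_of_nonneg_right
      (mul_le_mul (hA x) (hK _) (norm_nonneg _) hA0) (norm_nonneg _)
  have htest : ∀ k, IsTestFun Ω (fun x => ψ x * F (φ k x)) := by
    intro k
    have hs : tsupport (fun x => ψ x * F (φ k x)) ⊆ tsupport (φ k) := by
      apply closure_mono
      intro x hx hx0
      apply hx
      simp [hx0, hF0]
    refine ⟨hψ.mul (hF.comp (hφ k).1), ?_, hs.trans (hφ k).2.2⟩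
    exact (hφ k).2.1.of_isClosed_subset (isClosed_tsupport _) hs
  have h1' := h1.comp hmono.tendsto_atTop
  have h2' := h2.comp hmono.tendsto_atTop
  have iu : ∀ k, Integrable (fun x => (φ k x - u x) ^ 2) := fun k =>
    ((hφ k).memLp.sub hu).integrable_sq
  have iD : ∀ k, Integrable (fun x => ‖gradient (φ k) x - Du x‖ ^ 2) := fun k =>
    sq_norm_int ((hφ k).grad_memLp.sub hDu)
  refine ⟨m1, m2.add m3, fun k x => ψ x * F (φ (ns k) x), fun k => htest _, ?_, ?_⟩
  · have hlim := h1'.const_mul ((A * K) ^ 2)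
    rw [mul_zero] at hlim
    refine squeeze_zero (fun k => integral_nonneg fun x => sq_nonneg _) (fun k => ?_) hlim
    simp only [Function.comp]
    rw [← integral_const_mul]
    refine integral_mono (((htest (ns k)).memLp.sub m1).integrable_sq) ((iu (ns k)).const_mul _) ?_
    intro x
    simp only
    rw [← mul_pow, ← mul_sub]
    rw [← sq_abs (ψ x * _), ← sq_abs (A * K * _)]
    apply pow_le_pow_left₀ (abs_nonneg _)
    rw [abs_mul, abs_mul, abs_of_nonneg (mul_nonneg hA0 hK0), mul_assoc]
    exact mul_le_mul (hA x) (hlip _ _) (abs_nonneg _) hA0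
  · -- gradient
    have hdom : Tendsto (fun k => ∫ x, (A * |deriv F (φ (ns k) x) - deriv F (u x)| * ‖Du x‖) ^ 2)
        atTop (𝓝 0) := by
      have := tendsto_integral_of_dominated_convergence (μ := (volume : Measure (Euc n)))
        (F := fun k x => (A * |deriv F (φ (ns k) x) - deriv F (u x)| * ‖Du x‖) ^ 2)
        (f := fun _ => 0) (fun x => (A * (2 * K)) ^ 2 * ‖Du x‖ ^ 2) ?_ ?_ ?_ ?_
      · simpa using this
      · intro k
        exact ((aestronglyMeasurable_const.mul (((hF'c.comp
          (hφ (ns k)).1.continuous).aestronglyMeasurable.sub hF'meas).norm)).mul hDu.1.norm).pow 2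
      · exact (sq_norm_int hDu).const_mul _
      · intro k
        filter_upwards with x
        rw [Real.norm_eq_abs, abs_of_nonneg (sq_nonneg _), ← mul_pow]
        have : |deriv F (φ (ns k) x) - deriv F (u x)| ≤ 2 * K := by
          have := abs_sub (deriv F (φ (ns k) x)) (deriv F (u x))
          linarith [hK (φ (ns k) x), hK (u x)]
        gcongr
      · filter_upwards [hns] with x hx
        have h3 : Tendsto (fun k => deriv F (φ (ns k) x) - deriv F (u x)) atTop (𝓝 0) := by
          have := ((hF'c.tendsto (u x)).comp hx).sub_const (deriv F (u x))
          simpa using this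
        have h4 := (((h3.abs).const_mul A).mul_const ‖Du x‖).pow 2
        simpa using h4
    have hlim := (((h1'.const_mul ((B * K) ^ 2)).add (h2'.const_mul ((A * K) ^ 2))).add
      hdom).const_mul 3
    simp only [mul_zero, add_zero] at hlim
    refine squeeze_zero (fun k => integral_nonneg fun x => sq_nonneg _) (fun k => ?_) hlim
    simp only [Function.comp]
    have i3 : Integrable (fun x => (A * |deriv F (φ (ns k) x) - deriv F (u x)| * ‖Du x‖) ^ 2) := by
      refine ((sq_norm_int hDu).const_mul ((A * (2 * K)) ^ 2)).mono'
        (((aestronglyMeasurable_const.mul (((hF'c.comp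
          (hφ (ns k)).1.continuous).aestronglyMeasurable.sub hF'meas).norm)).mul hDu.1.norm).pow 2) ?_
      filter_upwards with x
      rw [Real.norm_eq_abs, abs_of_nonneg (sq_nonneg _), ← mul_pow]
      have : |deriv F (φ (ns k) x) - deriv F (u x)| ≤ 2 * K := by
        have := abs_sub (deriv F (φ (ns k) x)) (deriv F (u x))
        linarith [hK (φ (ns k) x), hK (u x)]
      gcongr
    have i1 := (iu (ns k)).const_mul ((B * K) ^ 2)
    have i2 := (iD (ns k)).const_mul ((A * K) ^ 2)
    have i12 : Integrable (fun x => (B * K) ^ 2 * (φ (ns k) x - u x) ^ 2 +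
      (A * K) ^ 2 * ‖gradient (φ (ns k)) x - Du x‖ ^ 2) := i1.add i2
    rw [← integral_const_mul, ← integral_const_mul, ← integral_add i1 i2,
      ← integral_add i12 i3, ← integral_const_mul]
    refine integral_mono (sq_norm_int ((htest (ns k)).grad_memLp.sub (m2.add m3)))
      ((i12.add i3).const_mul 3) ?_
    intro x
    simp only
    rw [grad_mul_comp hψ (hφ (ns k)).1 hF]
    set p := φ (ns k) x
    set g := gradient (φ (ns k)) x
    have e : F p • gradient ψ x + (ψ x * deriv F p) • g -
        (F (u x) • gradient ψ x + (ψ x * deriv F (u x)) • Du x) =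
        (F p - F (u x)) • gradient ψ x + (ψ x * deriv F p) • (g - Du x) +
          (ψ x * (deriv F p - deriv F (u x))) • Du x := by module
    rw [e]
    refine (three_sq _ _ _).trans ?_
    have b1 : ‖(F p - F (u x)) • gradient ψ x‖ ^ 2 ≤ (B * K) ^ 2 * (p - u x) ^ 2 := by
      rw [← mul_pow, ← sq_abs (B * K * (p - u x)), abs_mul, abs_of_nonneg (mul_nonneg hB0 hK0),
        norm_smul]
      apply pow_le_pow_left₀ (by positivity)
      calc _ ≤ (K * |p - u x|) * B := mul_le_mul (hlip _ _) (hB x) (norm_nonneg _) (by positivity)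
        _ = _ := by ring
    have b2 : ‖(ψ x * deriv F p) • (g - Du x)‖ ^ 2 ≤ (A * K) ^ 2 * ‖g - Du x‖ ^ 2 := by
      rw [← mul_pow, norm_smul, norm_mul]
      apply pow_le_pow_left₀ (by positivity)
      exact mul_le_mul_of_nonneg_right
        (mul_le_mul (hA x) (hK _) (norm_nonneg _) hA0) (norm_nonneg _)
    have b3 : ‖(ψ x * (deriv F p - deriv F (u x))) • Du x‖ ^ 2 ≤
        (A * |deriv F p - deriv F (u x)| * ‖Du x‖) ^ 2 := by
      rw [norm_smul, norm_mul]
      apply pow_le_pow_left₀ (by positivity)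
      exact mul_le_mul_of_nonneg_right
        (mul_le_mul_of_nonneg_right (hA x) (norm_nonneg _)) (norm_nonneg _)
    linarith

lemma two_sq {E : Type*} [SeminormedAddCommGroup E] [NormedSpace ℝ E] (a b : E) (t : ℝ) :
    ‖a + t • b‖ ^ 2 ≤ 2 * ‖a‖ ^ 2 + 2 * t ^ 2 * ‖b‖ ^ 2 := by
  have h := norm_add_le a (t • b)
  have h0 := norm_nonneg (a + t • b)
  have h1 : ‖t • b‖ ^ 2 = t ^ 2 * ‖b‖ ^ 2 := by rw [norm_smul, mul_pow]; simp
  nlinarith [sq_nonneg (‖a‖ - ‖t • b‖)]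

lemma MemH10.add_smul {n : ℕ} {Ω : Set (Euc n)} {u v : Euc n → ℝ} {Du Dv : Euc n → Euc n}
    (hu : MemH10 Ω u Du) (hv : MemH10 Ω v Dv) (t : ℝ) :
    MemH10 Ω (fun x => u x + t * v x) (fun x => Du x + t • Dv x) := by
  obtain ⟨hu, hDu, φ, hφ, h1, h2⟩ := hu
  obtain ⟨hv, hDv, ψ, hψ, h3, h4⟩ := hv
  have htest : ∀ k, IsTestFun Ω (fun x => φ k x + t * ψ k x) := by
    intro k
    have hs : tsupport (fun x => φ k x + t * ψ k x) ⊆ tsupport (φ k) ∪ tsupport (ψ k) := by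
      rw [tsupport, tsupport, tsupport, ← closure_union]
      apply closure_mono
      intro x hx
      by_contra hc
      simp only [mem_union, Function.mem_support, not_or, not_not] at hc
      apply hx
      simp [hc.1, hc.2]
    refine ⟨(hφ k).1.add (contDiff_const.mul (hψ k).1), ?_,
      hs.trans (union_subset (hφ k).2.2 (hψ k).2.2)⟩
    exact ((hφ k).2.1.isCompact.union (hψ k).2.1.isCompact).of_isClosed_subset
      (isClosed_tsupport _) hs
  have hg : ∀ k x, gradient (fun x => φ k x + t * ψ k x) x =
      gradient (φ k) x + t • gradient (ψ k) x := by
    intro k x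
    have e1 := ((hφ k).1.differentiable (by simp) x).hasFDerivAt
    have e2 := ((hψ k).1.differentiable (by simp) x).hasFDerivAt
    have h' : fderiv ℝ (fun x => φ k x + t * ψ k x) x = _ := (e1.add (e2.const_mul t)).fderiv
    unfold gradient
    rw [h']
    simp
  have m1 : MemLp (fun x => u x + t * v x) 2 volume := hu.add (hv.const_mul t)
  have m2 : MemLp (fun x => Du x + t • Dv x) 2 volume := hDu.add (hDv.const_smul t)
  refine ⟨m1, m2, _, htest, ?_, ?_⟩
  · have hlim := (h1.const_mul 2).add (h3.const_mul (2 * t ^ 2))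
    simp only [mul_zero, add_zero] at hlim
    refine squeeze_zero (fun k => integral_nonneg fun x => sq_nonneg _) (fun k => ?_) hlim
    have i1 := (((hφ k).memLp.sub hu).integrable_sq).const_mul 2
    have i2 := (((hψ k).memLp.sub hv).integrable_sq).const_mul (2 * t ^ 2)
    simp only [Pi.sub_apply] at i1 i2
    rw [← integral_const_mul, ← integral_const_mul, ← integral_add i1 i2]
    refine integral_mono (((htest k).memLp.sub m1).integrable_sq) (i1.add i2) ?_
    intro x
    simp only
    nlinarith [sq_nonneg ((φ k x - u x) - t * (ψ k x - v x))]
  · have hlim := (h2.const_mul 2).add (h4.const_mul (2 * t ^ 2))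
    simp only [mul_zero, add_zero] at hlim
    refine squeeze_zero (fun k => integral_nonneg fun x => sq_nonneg _) (fun k => ?_) hlim
    have i1 := (sq_norm_int ((hφ k).grad_memLp.sub hDu)).const_mul 2
    have i2 := (sq_norm_int ((hψ k).grad_memLp.sub hDv)).const_mul (2 * t ^ 2)
    simp only [Pi.sub_apply] at i1 i2
    rw [← integral_const_mul, ← integral_const_mul, ← integral_add i1 i2]
    refine integral_mono (sq_norm_int ((htest k).grad_memLp.sub m2)) (i1.add i2) ?_
    intro x
    simp only
    rw [hg]
    have e : gradient (φ k) x + t • gradient (ψ k) x - (Du x + t • Dv x) =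
      (gradient (φ k) x - Du x) + t • (gradient (ψ k) x - Dv x) := by module
    rw [e]
    exact two_sq _ _ _
lemma energy_eq {n : ℕ} {Ω : Set (Euc n)} (ho : IsOpen Ω) (hb : IsBounded Ω) {u : Euc n → ℝ}
    {Du : Euc n → Euc n} (h : MemH10 Ω u Du) :
    ∫ x, ((1 / 2) * ‖Du x‖ ^ 2 - u x) = (1 / 2) * (∫ x, ‖Du x‖ ^ 2) - ∫ x, u x := by
  rw [integral_sub ((sq_norm_int h.2.1).const_mul _) (h.integrable ho hb), integral_const_mul]

lemma tor_bdd {n : ℕ} (hn : 2 ≤ n) {Ω : Set (Euc n)} (ho : IsOpen Ω) (hb : IsBounded Ω) :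
    BddBelow {r | ∃ w Dw, MemH10 Ω w Dw ∧ r = ∫ x, ((1 / 2) * ‖Dw x‖ ^ 2 - w x)} := by
  obtain ⟨R, hR, hΩ⟩ := hb.subset_ball_lt 0 (0 : Euc n)
  have hn0 : (n : ℝ) ≠ 0 := by positivity
  let Y : Euc n → Euc n := fun y => (-(1 / (n:ℝ))) • (eta 0 R y • (y - 0))
  have hY : MemLp Y 2 volume := by
    apply Continuous.memLp_of_hasCompactSupport
    · have := (eta_contDiff (0 : Euc n) R).continuous
      simp only [Y]
      fun_prop
    · exact supp_of (x := 0) hR (fun y hy => by simp [Y, eta_zero hy])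
  refine ⟨-(1 / 2) * ∫ y, ‖Y y‖ ^ 2, ?_⟩
  rintro r ⟨u, Du, h, rfl⟩
  have hd := h.div 0 hR
  have e1 : ∫ y, u y * dv 0 R y = n * ∫ y, u y := by
    rw [← integral_const_mul]
    apply integral_congr_ae
    filter_upwards [h.ae_zero] with y hy
    by_cases hyΩ : y ∈ Ω
    · have := ss_in' hR (hΩ hyΩ)
      have e : eta 0 R y = 1 := Real.smoothTransition.one_of_one_le (by linarith)
      rw [dv, e, HH_deriv_of_one_lt (by linarith)]
      ring
    · simp [hy hyΩ]
  have e2 : ∫ y, u y = ∫ y, inner ℝ (Du y) (Y y) := by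
    simp only [Y, inner_smul_right _ _ (-(1 / (n:ℝ)))]
    rw [integral_const_mul, hd, e1]
    field_simp
  rw [energy_eq ho hb h, e2, ← integral_const_mul, ← integral_const_mul,
    ← integral_sub ((sq_norm_int h.2.1).const_mul _) (inner_int h.2.1 hY)]
  refine integral_mono ((sq_norm_int hY).const_mul _)
    (((sq_norm_int h.2.1).const_mul _).sub (inner_int h.2.1 hY)) ?_
  intro y
  simp only
  have := norm_sub_sq_real (Du y) (Y y)
  nlinarith [sq_nonneg ‖Du y - Y y‖]

lemma euler_lagrange {n : ℕ} (hn : 2 ≤ n) {Ω : Set (Euc n)} (ho : IsOpen Ω) (hb : IsBounded Ω)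
    {w : Euc n → ℝ} {Dw : Euc n → Euc n} (hw : MemH10 Ω w Dw)
    (hmin : (∫ x, ((1 / 2) * ‖Dw x‖ ^ 2 - w x)) = tor Ω)
    {u : Euc n → ℝ} {Du : Euc n → Euc n} (hu : MemH10 Ω u Du) :
    ∫ x, inner ℝ (Dw x) (Du x) = ∫ x, u x := by
  set a := (∫ x, inner ℝ (Dw x) (Du x)) - ∫ x, u x with ha
  set b := (1 / 2) * ∫ x, ‖Du x‖ ^ 2 with hbb
  have hb0 : 0 ≤ b := by
    have : 0 ≤ ∫ x, ‖Du x‖ ^ 2 := integral_nonneg fun x => sq_nonneg _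
    positivity
  have key : ∀ t : ℝ, 0 ≤ t * a + t ^ 2 * b := by
    intro t
    have hm := hw.add_smul hu t
    have h1 : tor Ω ≤ _ := csInf_le (tor_bdd hn ho hb) ⟨_, _, hm, rfl⟩
    rw [← hmin, energy_eq ho hb hw, energy_eq ho hb hm] at h1
    have e1 : ∫ x, ‖Dw x + t • Du x‖ ^ 2 = (∫ x, ‖Dw x‖ ^ 2) +
        2 * t * (∫ x, inner ℝ (Dw x) (Du x)) + t ^ 2 * ∫ x, ‖Du x‖ ^ 2 := by
      have i1 := sq_norm_int hw.2.1
      have i2 := (inner_int hw.2.1 hu.2.1).const_mul (2 * t)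
      have i3 := (sq_norm_int hu.2.1).const_mul (t ^ 2)
      have i12 : Integrable (fun x => ‖Dw x‖ ^ 2 + 2 * t * inner ℝ (Dw x) (Du x)) := i1.add i2
      rw [← integral_const_mul, ← integral_const_mul, ← integral_add i1 i2, ← integral_add i12 i3]
      congr 1; ext x
      rw [norm_add_sq_real, inner_smul_right, norm_smul, mul_pow]
      simp; ring
    have e2 : ∫ x, (w x + t * u x) = (∫ x, w x) + t * ∫ x, u x := by
      rw [← integral_const_mul, ← integral_add (hw.integrable ho hb)
        ((hu.integrable ho hb).const_mul t)]
    rw [e1, e2] at h1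
    rw [ha, hbb]
    linarith
  have h := key (-a / (b + 1))
  have h2 : -a / (b + 1) * a + (-a / (b + 1)) ^ 2 * b = -(a ^ 2 / (b + 1) ^ 2) := by
    field_simp; ring
  rw [h2] at h
  have h3 : a ^ 2 / (b + 1) ^ 2 = 0 := le_antisymm (by linarith) (by positivity)
  have : a = 0 := by
    have hb1 : (b + 1) ^ 2 ≠ 0 := by positivity
    simpa [hb1, div_eq_zero_iff, (by positivity : b + 1 ≠ 0)] using h3
  linarith

lemma memH10_GG {n : ℕ} {Ω : Set (Euc n)} {w : Euc n → ℝ} {Dw : Euc n → Euc n}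
    (hw : MemH10 Ω w Dw) : MemH10 Ω (fun x => GG (w x)) (fun x => HH (w x) • Dw x) := by
  have h := hw.mul_comp (ψ := fun _ => 1) contDiff_const (A := 1) (B := 0) (by simp)
    (by simp [gradient_fun_const]) GG_contDiff GG_zero (K := 1) (by
      intro s; rw [GG_deriv, abs_of_nonneg (Real.smoothTransition.nonneg s)]
      exact Real.smoothTransition.le_one s)
  simpa [gradient_fun_const, GG_deriv] using h

lemma int_GG_le {n : ℕ} (hn : 2 ≤ n) {Ω : Set (Euc n)} (ho : IsOpen Ω) (hb : IsBounded Ω)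
    {T : ℝ} (hT : -T ≤ tor Ω) {w : Euc n → ℝ} {Dw : Euc n → Euc n} (hw : MemH10 Ω w Dw)
    (hmin : (∫ x, ((1 / 2) * ‖Dw x‖ ^ 2 - w x)) = tor Ω) : ∫ x, GG (w x) ≤ 2 * T := by
  have h1 := euler_lagrange hn ho hb hw hmin hw
  have h2 := euler_lagrange hn ho hb hw hmin (memH10_GG hw)
  rw [← hmin, energy_eq ho hb hw] at hT
  simp only [real_inner_self_eq_norm_sq] at h1
  have h3 : ∫ x, inner ℝ (Dw x) (HH (w x) • Dw x) ≤ ∫ x, ‖Dw x‖ ^ 2 := by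
    refine integral_mono (inner_int hw.2.1 (memH10_GG hw).2.1) (sq_norm_int hw.2.1) ?_
    intro x
    simp only [inner_smul_right, real_inner_self_eq_norm_sq]
    have := Real.smoothTransition.le_one (w x)
    nlinarith [sq_nonneg ‖Dw x‖]
  linarith

lemma int_dv_le {n : ℕ} (hn : 2 ≤ n) {Ω : Set (Euc n)} (ho : IsOpen Ω) (hb : IsBounded Ω)
    {w : Euc n → ℝ} {Dw : Euc n → Euc n} (hw : MemH10 Ω w Dw)
    (hmin : (∫ x, ((1 / 2) * ‖Dw x‖ ^ 2 - w x)) = tor Ω) (x : Euc n) {t : ℝ} (ht : 0 < t) :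
    ∫ y, GG (w y) * dv x t y ≤ t ^ 2 * ∫ y, psi x t y := by
  have hps : HasCompactSupport (psi x t) := supp_of ht fun y hy => psi_zero hy
  have hgc := grad_cont (psi_contDiff x t)
  have hgs : HasCompactSupport (gradient (psi x t)) :=
    supp_of ht fun y hy => by rw [psi_grad, eta_zero hy]; simp
  obtain ⟨A, hA⟩ := hps.exists_bound_of_continuous (psi_contDiff x t).continuous
  obtain ⟨B, hB⟩ := hgs.exists_bound_of_continuous hgc
  obtain ⟨K, hK0, hK⟩ := HH_deriv_bdd
  have hu := hw.mul_comp (psi_contDiff x t) hA hB HH_contDiff Real.smoothTransition.zero hK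
  have hel := euler_lagrange hn ho hb hw hmin hu
  have hpi : Integrable (psi x t) :=
    (psi_contDiff x t).continuous.integrable_of_hasCompactSupport hps
  have h1 : ∫ y, psi x t y * HH (w y) ≤ ∫ y, psi x t y := by
    refine integral_mono (hu.integrable ho hb) hpi ?_
    intro y
    have := Real.smoothTransition.le_one (w y)
    have := psi_nonneg x t y
    simp only
    nlinarith
  have hgL : MemLp (gradient (psi x t)) 2 volume := hgc.memLp_of_hasCompactSupport hgs
  have hv := memH10_GG hw
  have h2 : ∫ y, inner ℝ (HH (w y) • Dw y) (gradient (psi x t) y) ≤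
      ∫ y, inner ℝ (Dw y) (HH (w y) • gradient (psi x t) y +
        (psi x t y * deriv HH (w y)) • Dw y) := by
    refine integral_mono (inner_int hv.2.1 hgL) (inner_int hw.2.1 hu.2.1) ?_
    intro y
    simp only [inner_add_right, inner_smul_right, inner_smul_left, real_inner_self_eq_norm_sq]
    have : 0 ≤ psi x t y * deriv HH (w y) * ‖Dw y‖ ^ 2 :=
      mul_nonneg (mul_nonneg (psi_nonneg x t y) (HH_deriv_nonneg _)) (sq_nonneg _)
    simpa using this
  have h3 : ∫ y, inner ℝ (HH (w y) • Dw y) (gradient (psi x t) y) =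
      -(1 / t ^ 2) * ∫ y, inner ℝ (HH (w y) • Dw y) (eta x t y • (y - x)) := by
    rw [← integral_const_mul]
    congr 1; ext y
    rw [psi_grad, inner_smul_right, inner_smul_right]
    ring
  rw [hv.div x ht] at h3
  have h4 : (1 / t ^ 2) * ∫ y, GG (w y) * dv x t y ≤ ∫ y, psi x t y := by linarith
  rw [one_div, inv_mul_le_iff₀ (by positivity)] at h4
  exact h4

lemma int_psi {n : ℕ} (x : Euc n) {t : ℝ} (ht : 0 < t) :
    ∫ y, psi x t y = t ^ n * ∫ y, psi (0 : Euc n) 1 y := by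
  have e : ∀ y, psi x t y = psi (0 : Euc n) 1 (t⁻¹ • (y - x)) := by
    intro y
    simp [psi, ss, norm_smul, mul_pow, abs_of_pos ht]
    ring_nf
  simp_rw [e]
  rw [integral_sub_right_eq_self (fun y : Euc n => psi (0 : Euc n) 1 (t⁻¹ • y)) x,
    Measure.integral_comp_inv_smul_of_nonneg _ _ ht.le]
  simp

lemma eta_hasDeriv {n : ℕ} (x y : Euc n) {t : ℝ} (ht : 0 < t) :
    HasDerivAt (fun t => (t ^ n)⁻¹ * eta x t y) (-(t ^ (n + 1))⁻¹ * dv x t y) t := by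
  have h1 : HasDerivAt (fun t : ℝ => (t ^ n)⁻¹) (-(n * t ^ (n - 1)) / (t ^ n) ^ 2) t :=
    (hasDerivAt_pow n t).inv (by positivity)
  have h2 : HasDerivAt (fun t : ℝ => ss x t y) (‖y - x‖ ^ 2 * (-(2 * t) / (t ^ 2) ^ 2)) t := by
    have := ((hasDerivAt_pow 2 t).inv (by positivity)).const_mul (‖y - x‖ ^ 2)
    simpa [ss, div_eq_mul_inv] using this
  have h3 : HasDerivAt (fun t => eta x t y) _ t :=
    (HH_hasDeriv (2 - ss x t y)).comp t (h2.const_sub 2)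
  refine (h1.mul h3).congr_deriv ?_
  simp only [dv, eta, ss]
  rcases n with _ | m
  · simp
    field_simp
  · simp
    field_simp
    ring

lemma dv_bdd {n : ℕ} : ∃ D : ℝ, ∀ (x y : Euc n) (t : ℝ), |dv x t y| ≤ D := by
  obtain ⟨K, hK0, hK⟩ := HH_deriv_bdd
  refine ⟨n + 4 * K, fun x y t => ?_⟩
  rcases lt_or_ge 2 (ss x t y) with h | h
  · rw [dv_zero h]; simp; positivity
  · have h0 := ss_nonneg x t y
    have := hK (2 - ss x t y)
    have h1 := HH_deriv_nonneg (2 - ss x t y)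
    rw [abs_of_nonneg h1] at this
    have h2 := eta_nonneg x t y
    have h3 := eta_le x t y
    have hn : (0:ℝ) ≤ n := by positivity
    have h4 : (n:ℝ) * eta x t y ≤ n := by nlinarith
    have h5 : 0 ≤ (n:ℝ) * eta x t y := by positivity
    have h6 : ss x t y * deriv HH (2 - ss x t y) ≤ 2 * K := mul_le_mul h this h1 (by norm_num)
    have h7 : 0 ≤ ss x t y * deriv HH (2 - ss x t y) := by positivity
    rw [dv, abs_le]
    constructor <;> nlinarith

lemma M_hasDeriv {n : ℕ} {v : Euc n → ℝ} (hv : Integrable v) (x : Euc n) {t : ℝ} (ht : 0 < t) :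
    HasDerivAt (fun t => ∫ y, v y * ((t ^ n)⁻¹ * eta x t y))
      (-(t ^ (n + 1))⁻¹ * ∫ y, v y * dv x t y) t := by
  obtain ⟨D, hD⟩ := dv_bdd (n := n)
  have hD0 : 0 ≤ D := (abs_nonneg _).trans (hD 0 0 0)
  have hm : ∀ t, AEStronglyMeasurable (fun y => v y * ((t ^ n)⁻¹ * eta x t y)) volume := fun t =>
    hv.1.mul (continuous_const.mul (eta_contDiff x t).continuous).aestronglyMeasurable
  have h := hasDerivAt_integral_of_dominated_loc_of_deriv_le (μ := (volume : Measure (Euc n)))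
    (F := fun t y => v y * ((t ^ n)⁻¹ * eta x t y))
    (F' := fun t y => v y * (-(t ^ (n + 1))⁻¹ * dv x t y)) (x₀ := t) (s := Ioi (t / 2))
    (bound := fun y => |v y| * (((t / 2) ^ (n + 1))⁻¹ * D))
    (Ioi_mem_nhds (by linarith)) (Eventually.of_forall hm) ?_ ?_ ?_ ?_ ?_
  · refine h.2.congr_deriv ?_
    rw [← integral_const_mul]
    congr 1; ext y; ring
  · refine (hv.abs.mul_const ((t ^ n)⁻¹)).mono' (hm t) ?_
    filter_upwards with y
    rw [norm_mul]
    apply mul_le_mul_of_nonneg_left _ (norm_nonneg _)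
    rw [Real.norm_eq_abs, abs_of_nonneg (mul_nonneg (by positivity) (eta_nonneg x t y))]
    exact mul_le_of_le_one_right (by positivity) (eta_le x t y)
  · exact hv.1.mul (continuous_const.mul (dv_cont x t)).aestronglyMeasurable
  · filter_upwards with y s hs
    have hs' : t / 2 < s := hs
    have hs0 : 0 < s := by linarith
    rw [norm_mul, norm_mul, norm_neg]
    apply mul_le_mul_of_nonneg_left _ (norm_nonneg _)
    refine mul_le_mul ?_ (hD _ _ _) (norm_nonneg _) (by positivity)
    rw [Real.norm_eq_abs, abs_of_nonneg (by positivity)]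
    gcongr
  · exact hv.abs.mul_const _
  · filter_upwards with y s hs
    have hs' : t / 2 < s := hs
    exact (eta_hasDeriv x y (by linarith)).const_mul (v y)
/-- **Torsion function upper bound.** For `n ≥ 2` and `T > 0` there is a constant
`C(n,T)` such that every nonempty bounded open `Ω ⊆ ℝⁿ` with `tor Ω ≥ −T` has its
torsion function bounded: `w_Ω ≤ C(n,T)` a.e. -/
theorem torsion_function_upper_bound (n : ℕ) (hn : 2 ≤ n) (T : ℝ) (hT : 0 < T) :
    ∃ C : ℝ, 0 < C ∧
      ∀ Ω : Set (Euc n), IsOpen Ω → Ω.Nonempty → IsBounded Ω →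
        -T ≤ tor Ω →
        ∀ w : Euc n → ℝ, IsTorsionFun Ω w →
          ∀ᵐ x ∂volume, w x ≤ C := by
  set P := ∫ y, psi (0 : Euc n) 1 y with hP
  have hP0 : 0 ≤ P := integral_nonneg fun y => psi_nonneg _ _ _
  set c := (volume : Measure (Euc n)).real (ball 0 1) with hc
  have hc0 : 0 < c := 
    ENNReal.toReal_pos (measure_ball_pos _ _ one_pos).ne' measure_ball_lt_top.ne
  refine ⟨1 + (2 * T + P / 2) / c, by positivity, ?_⟩
  intro Ω ho _ hb htor w ⟨_, Dw, hw, hmin⟩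
  have hv := (memH10_GG hw).integrable ho hb
  have hvT := int_GG_le hn ho hb htor hw hmin
  have hM : ∀ x : Euc n, ∀ δ : ℝ, 0 < δ → δ ≤ 1 →
      ∫ y, GG (w y) * ((δ ^ n)⁻¹ * eta x δ y) ≤ 2 * T + P / 2 := by
    intro x δ hδ hδ1
    have hN : ∀ t : ℝ, 0 < t → HasDerivAt
        (fun t => (∫ y, GG (w y) * ((t ^ n)⁻¹ * eta x t y)) + P / 2 * t ^ 2)
        (-(t ^ (n + 1))⁻¹ * (∫ y, GG (w y) * dv x t y) + P * t) t := by
      intro t ht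
      refine ((M_hasDeriv hv x ht).add ((hasDerivAt_pow 2 t).const_mul (P / 2))).congr_deriv ?_
      push_cast
      ring
    have hmono : MonotoneOn
        (fun t => (∫ y, GG (w y) * ((t ^ n)⁻¹ * eta x t y)) + P / 2 * t ^ 2) (Ioi 0) := by
      apply monotoneOn_of_deriv_nonneg (convex_Ioi 0)
      · exact fun t ht => (hN t ht).continuousAt.continuousWithinAt
      · intro t ht
        rw [interior_Ioi] at ht
        exact (hN t ht).differentiableAt.differentiableWithinAt
      · intro t ht
        rw [interior_Ioi] at ht
        have ht0 : 0 < t := ht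
        rw [(hN t ht).deriv]
        have h1 := int_dv_le hn ho hb hw hmin x ht0
        rw [int_psi x ht0, ← hP] at h1
        have h2 : (t ^ (n + 1))⁻¹ * (∫ y, GG (w y) * dv x t y) ≤
            (t ^ (n + 1))⁻¹ * (t ^ 2 * (t ^ n * P)) :=
          mul_le_mul_of_nonneg_left h1 (by positivity)
        have h3 : (t ^ (n + 1))⁻¹ * (t ^ 2 * (t ^ n * P)) = P * t := by
          field_simp
          ring
        linarith
    have h1 := hmono (mem_Ioi.2 hδ) (mem_Ioi.2 one_pos) hδ1
    simp only [one_pow, inv_one, one_mul, mul_one] at h1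
    have h2 : ∫ y, GG (w y) * eta x 1 y ≤ ∫ y, GG (w y) := by
      refine integral_mono_of_nonneg ?_ hv ?_
      · filter_upwards with y
        exact mul_nonneg (GG_nonneg _) (eta_nonneg _ _ _)
      · filter_upwards with y
        exact mul_le_of_le_one_right (GG_nonneg _) (eta_le _ _ _)
    have : 0 ≤ P / 2 * δ ^ 2 := by positivity
    linarith
  have hav : ∀ x : Euc n, ∀ δ : ℝ, 0 < δ → δ ≤ 1 →
      ⨍ y in closedBall x δ, GG (w y) ≤ (2 * T + P / 2) / c := by
    intro x δ hδ hδ1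
    have hvol : (volume : Measure (Euc n)).real (closedBall x δ) = δ ^ n * c := by
      rw [hc, measureReal_def, measureReal_def, Measure.addHaar_closedBall _ _ hδ.le,
        ENNReal.toReal_mul, ENNReal.toReal_ofReal (by positivity)]
      simp
    have hi : Integrable (fun y => GG (w y) * ((δ ^ n)⁻¹ * eta x δ y)) := by
      refine (hv.mul_const ((δ ^ n)⁻¹)).mono' (hv.1.mul
        (continuous_const.mul (eta_contDiff x δ).continuous).aestronglyMeasurable) ?_
      filter_upwards with y
      have h0 : 0 ≤ (δ ^ n)⁻¹ := by positivity
      rw [Real.norm_eq_abs, abs_of_nonneg (mul_nonneg (GG_nonneg _)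
        (mul_nonneg h0 (eta_nonneg x δ y)))]
      exact mul_le_mul_of_nonneg_left (mul_le_of_le_one_right h0 (eta_le x δ y)) (GG_nonneg _)
    have h1 : ∫ y in closedBall x δ, GG (w y) * (δ ^ n)⁻¹ ≤
        ∫ y, GG (w y) * ((δ ^ n)⁻¹ * eta x δ y) := by
      have e : ∫ y in closedBall x δ, GG (w y) * (δ ^ n)⁻¹ =
          ∫ y in closedBall x δ, GG (w y) * ((δ ^ n)⁻¹ * eta x δ y) := by
        apply setIntegral_congr_fun measurableSet_closedBall
        intro y hy
        have := ss_in hδ hy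
        have e : eta x δ y = 1 := Real.smoothTransition.one_of_one_le (by linarith)
        simp [e]
      rw [e]
      apply setIntegral_le_integral hi
      filter_upwards with y
      exact mul_nonneg (GG_nonneg _) (mul_nonneg (by positivity) (eta_nonneg x δ y))
    rw [integral_mul_const] at h1
    have h2 := h1.trans (hM x δ hδ hδ1)
    rw [setAverage_eq, hvol, smul_eq_mul, mul_inv, le_div_iff₀ hc0]
    calc _ = (∫ y in closedBall x δ, GG (w y)) * (δ ^ n)⁻¹ := by field_simp
      _ ≤ _ := h2
  filter_upwards [IsUnifLocDoublingMeasure.ae_tendsto_average (μ := (volume : Measure (Euc n)))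
    hv.locallyIntegrable 1] with x hx
  have hlim := hx (l := 𝓝[>] (0:ℝ)) (fun _ => x) (fun δ => δ) tendsto_id (by
    filter_upwards [self_mem_nhdsWithin] with δ hδ
    have : (0:ℝ) < δ := hδ
    simp [this.le])
  have hle : GG (w x) ≤ (2 * T + P / 2) / c := by
    refine le_of_tendsto hlim ?_
    filter_upwards [Ioc_mem_nhdsGT (zero_lt_one' ℝ)] with δ hδ
    exact hav x δ hδ.1 hδ.2
  linarith [GG_ge (w x)]
end
end

section
/- Quantitative closeness of almost-minimizers of a Rayleigh quotient to the ground state (abstract spectral gap lemma): Let H be a real vector space equipped with an inner product ⟨·,·⟩ and a symmetric bilinear form b. Let λ₁ ≥ 0, α > 0 and u₁ ∈ H satisfy ⟨u₁,u₁⟩ = 1, b(u₁, φ) = λ₁·⟨u₁, φ⟩ for all φ ∈ H, and b(w,w) ≥ (λ₁ + α)·⟨w,w⟩ for every w ∈ H with ⟨w, u₁⟩ = 0. Then for every v ∈ H with ⟨v,v⟩ = 1 and ⟨v, u₁⟩ ≥ 0, one has b(u₁ − v, u₁ − v) ≤ (1 + 2λ₁/α)·( b(v,v) − λ₁ ). 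-/
/-- **Abstract spectral gap lemma: quantitative closeness of almost-minimizers of a
Rayleigh quotient to the ground state.** Let `H` be a real vector space with an inner
product `inn` and a symmetric bilinear form `b`. Suppose `u₁` is a normalized ground
state: `inn u₁ u₁ = 1`, `b u₁ φ = lam1 · inn u₁ φ` for all `φ`, and the spectral gap
`b w w ≥ (lam1 + α) · inn w w` holds for all `w` orthogonal to `u₁`. Then every `v`
with `inn v v = 1` and `inn v u₁ ≥ 0` satisfies
`b (u₁ − v) (u₁ − v) ≤ (1 + 2·lam1/α)·(b v v − lam1)`. -/
theorem abstract_spectral_gap_lemma (H : Type*) [AddCommGroup H] [Module ℝ H]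
    (inn b : H →ₗ[ℝ] H →ₗ[ℝ] ℝ)
    (hinn_symm : ∀ x y : H, inn x y = inn y x)
    (hinn_nonneg : ∀ x : H, 0 ≤ inn x x)
    (hinn_def : ∀ x : H, inn x x = 0 → x = 0)
    (hb_symm : ∀ x y : H, b x y = b y x)
    (lam1 α : ℝ) (hlam1 : 0 ≤ lam1) (hα : 0 < α)
    (u₁ : H) (hu₁ : inn u₁ u₁ = 1)
    (heigen : ∀ φ : H, b u₁ φ = lam1 * inn u₁ φ)
    (hgap : ∀ w : H, inn w u₁ = 0 → (lam1 + α) * inn w w ≤ b w w) :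
    ∀ v : H, inn v v = 1 → 0 ≤ inn v u₁ →
      b (u₁ - v) (u₁ - v) ≤ (1 + 2 * lam1 / α) * (b v v - lam1) := by
  intro v hv hc
  have hw := hgap (v - (inn v u₁) • u₁) (by simp [hu₁])
  have hn := hinn_nonneg (v - (inn v u₁) • u₁)
  have e1 : inn (v - (inn v u₁) • u₁) (v - (inn v u₁) • u₁) = 1 - (inn v u₁) ^ 2 := by
    simp only [map_sub, map_smul, LinearMap.sub_apply, LinearMap.smul_apply, smul_eq_mul, hu₁, hv,
      hinn_symm u₁ v]
    ring
  have e2 : b (v - (inn v u₁) • u₁) (v - (inn v u₁) • u₁) = b v v - lam1 * (inn v u₁) ^ 2 := by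
    simp only [map_sub, map_smul, LinearMap.sub_apply, LinearMap.smul_apply, smul_eq_mul,
      hb_symm v u₁, heigen, hu₁, hinn_symm u₁ v]
    ring
  have e3 : b (u₁ - v) (u₁ - v) = b v v - lam1 + 2 * lam1 * (1 - inn v u₁) := by
    simp only [map_sub, LinearMap.sub_apply, hb_symm v u₁, heigen, hu₁, hinn_symm u₁ v]
    ring
  rw [e1] at hw hn
  rw [e2] at hw
  rw [e3]
  generalize inn v u₁ = c at *
  generalize b v v = B at *
  have hc1 : c ≤ 1 := by nlinarith
  have h1 : 1 - c ≤ (B - lam1) / α := by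
    rw [le_div_iff₀ hα]
    nlinarith [mul_nonneg hα.le (mul_nonneg hc (sub_nonneg.2 hc1))]
  have h2 := mul_le_mul_of_nonneg_left h1 (by positivity : 0 ≤ 2 * lam1)
  have h3 : (1 + 2 * lam1 / α) * (B - lam1) = B - lam1 + 2 * lam1 * ((B - lam1) / α) := by ring
  linarith
end
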